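/- arXiv:1606.07867 — 10 statements merged into one kernel-verified Lean document; each statement's English description precedes it below -/
import Mathlib

section
/- Let G be a finite group and G′ a finite group. Then G′ is a GI-extension of G if and only if there exists an automorphism σ of G with σ ∘ σ = id such that G is generated by the set {g ∈ G : σ(g) = g⁻¹} and G′ is isomorphic to the semidirect product G ⋊_σ C₂ in which the nontrivial element of C₂ acts on G by σ. -/
/-- `G'` is a GI-extension of `G`: `G'` contains a normal subgroup `N` of index 2
isomorphic to `G` such that `G'` is generated by its elements of order 2 not
contained in `N`. -/
def IsGIExtension (G G' : Type*) [Group G] [Group G'] : Prop :=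
  ∃ N : Subgroup G', N.Normal ∧ N.index = 2 ∧ Nonempty (N ≃* G) ∧
    Subgroup.closure {x : G' | orderOf x = 2 ∧ x ∉ N} = ⊤

namespace SemidirectProduct

/-- The homomorphism from the cyclic group of order two determined by an element of square `1`. -/
def homOfMulSelf {A : Type*} [Group A] (a : A) (ha : a * a = 1) :
    Multiplicative (ZMod 2) →* A where
  toFun c := if c = 1 then 1 else a
  map_one' := if_pos rfl
  map_mul' c d := by
    have h : ∀ c d : Multiplicative (ZMod 2), c ≠ 1 → d ≠ 1 → c * d = 1 := by decide
    by_cases hc : c = 1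
    · simp [hc]
    · by_cases hd : d = 1
      · simp [hd]
      · simp [hc, hd, h c d hc hd, ha]

@[simp]
theorem homOfMulSelf_ofAdd_one {A : Type*} [Group A] (a : A) (ha : a * a = 1) :
    homOfMulSelf a ha (Multiplicative.ofAdd 1) = a := by
  have h : Multiplicative.ofAdd (1 : ZMod 2) ≠ 1 := by decide
  simp [homOfMulSelf, h]

theorem eq_ofAdd_one_of_ne_one {c : Multiplicative (ZMod 2)} (hc : c ≠ 1) :
    c = Multiplicative.ofAdd 1 := by
  revert c; decide

variable {G : Type*} [Group G] {φ : Multiplicative (ZMod 2) →* MulAut G}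

theorem orderOf_eq_two_iff_of_right_ne_one {x : G ⋊[φ] Multiplicative (ZMod 2)}
    (hx : x.right ≠ 1) :
    orderOf x = 2 ↔ φ (Multiplicative.ofAdd 1) x.left = x.left⁻¹ := by
  have hr := eq_ofAdd_one_of_ne_one hx
  have hx1 : x ≠ 1 := by
    rintro rfl
    exact hx rfl
  rw [orderOf_eq_prime_iff, and_iff_left hx1, pow_two, SemidirectProduct.ext_iff, mul_left,
    mul_right, hr, one_left, one_right, and_iff_left (by decide), mul_eq_one_iff_inv_eq, eq_comm]

theorem closure_orderOf_eq_two_eq_top_iff :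
    Subgroup.closure {x : G ⋊[φ] Multiplicative (ZMod 2) | orderOf x = 2 ∧ x.right ≠ 1} = ⊤ ↔
      Subgroup.closure {g : G | φ (Multiplicative.ofAdd 1) g = g⁻¹} = ⊤ := by
  set S := {x : G ⋊[φ] Multiplicative (ZMod 2) | orderOf x = 2 ∧ x.right ≠ 1}
  set T := {g : G | φ (Multiplicative.ofAdd 1) g = g⁻¹}
  have hST {x : G ⋊[φ] Multiplicative (ZMod 2)} (hx : x.right ≠ 1) : x ∈ S ↔ x.left ∈ T :=
    (and_iff_left hx).trans (orderOf_eq_two_iff_of_right_ne_one hx)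
  constructor
  · intro h
    have hφ : ∀ c, ∀ g ∈ Subgroup.closure T, φ c g ∈ Subgroup.closure T := by
      intro c g hg
      by_cases hc : c = 1
      · simpa [hc] using hg
      rw [eq_ofAdd_one_of_ne_one hc]
      induction hg using Subgroup.closure_induction with
      | mem g hg =>
        rw [show φ (Multiplicative.ofAdd 1) g = g⁻¹ from hg]
        exact inv_mem (Subgroup.subset_closure hg)
      | one => simp
      | mul a b _ _ ha hb => simpa using mul_mem ha hb
      | inv a _ ha => simpa using ha
    let M : Subgroup (G ⋊[φ] Multiplicative (ZMod 2)) :=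
      { carrier := {x | x.left ∈ Subgroup.closure T}
        one_mem' := one_mem (Subgroup.closure T)
        mul_mem' := fun ha hb => mul_mem ha (hφ _ _ hb)
        inv_mem' := fun ha => hφ _ _ (inv_mem ha) }
    have hM : Subgroup.closure S ≤ M :=
      (Subgroup.closure_le M).2 fun x hx => Subgroup.subset_closure ((hST hx.2).1 hx)
    rw [h] at hM
    exact eq_top_iff.2 fun g _ => hM (Subgroup.mem_top (inl g))
  · intro h
    have hmk : ∀ g ∈ T, inl g * inr (Multiplicative.ofAdd 1) ∈ Subgroup.closure S := by
      intro g hg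
      have hne : (inl g * inr (Multiplicative.ofAdd 1) :
          G ⋊[φ] Multiplicative (ZMod 2)).right ≠ 1 := by
        simp only [mul_right, right_inl, right_inr, one_mul]
        decide
      exact Subgroup.subset_closure ((hST hne).2 (by simpa using hg))
    have hinr : inr (Multiplicative.ofAdd 1) ∈ Subgroup.closure S := by
      simpa using hmk 1 (by simp [T])
    have hinl : Subgroup.closure T ≤ (Subgroup.closure S).comap inl :=
      (Subgroup.closure_le _).2 fun g hg =>
        (Subgroup.mul_mem_cancel_right _ hinr).1 (hmk g hg)
    rw [h] at hinl
    refine eq_top_iff.2 fun x _ => ?_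
    rw [← inl_left_mul_inr_right x]
    refine mul_mem (hinl (Subgroup.mem_top _)) ?_
    by_cases hx : x.right = 1
    · simp [hx]
    · rwa [eq_ofAdd_one_of_ne_one hx]

/-- An involution `t` outside a subgroup `N` of index two splits the group as `N ⋊ C₂`,
compatibly with membership in `N`. -/
theorem exists_mulEquiv_of_index_two {G' : Type*} [Group G'] {N : Subgroup G'} [N.Normal]
    (hN : N.index = 2) (e : N ≃* G) {t : G'} (ht : t * t = 1) (htN : t ∉ N) :
    ∃ (φ : Multiplicative (ZMod 2) →* MulAut G) (L : G ⋊[φ] Multiplicative (ZMod 2) ≃* G'),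
      ∀ x, L x ∈ N ↔ x.right = 1 := by
  let f := homOfMulSelf t ht
  have hf : ∀ c, f c ∈ N ↔ c = 1 := by
    intro c
    by_cases hc : c = 1
    · simp [hc]
    · rw [eq_ofAdd_one_of_ne_one hc]
      exact iff_of_false (by simpa [f] using htN) (by decide)
  let φ : Multiplicative (ZMod 2) →* MulAut G :=
    (MulAut.congr e).toMonoidHom.comp (MulAut.conjNormal.comp f)
  let L : G ⋊[φ] Multiplicative (ZMod 2) →* G' :=
    lift (N.subtype.comp e.symm.toMonoidHom) f fun c => by
      ext g
      simp [φ, MulAut.congr]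
  have hL : ∀ x, L x = e.symm x.left * f x.right := fun _ => rfl
  have hLN : ∀ x, L x ∈ N ↔ x.right = 1 := fun x => by
    rw [hL, Subgroup.mul_mem_cancel_left _ (SetLike.coe_mem _), hf]
  have hbij : Function.Bijective L := by
    constructor
    · refine (injective_iff_map_eq_one L).2 fun x hx => ?_
      have hr : x.right = 1 := (hLN x).1 (hx ▸ one_mem N)
      rw [hL, hr, map_one, mul_one] at hx
      exact SemidirectProduct.ext (by simpa using hx) hr
    · have hmem : ∀ y ∈ N, ∃ x, L x = y := fun y hy =>
        ⟨inl (e ⟨y, hy⟩), by simp [hL]⟩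
      intro y
      by_cases hy : y ∈ N
      · exact hmem y hy
      · obtain ⟨x, hx⟩ := hmem (y * t)
          ((Subgroup.mul_mem_iff_of_index_two hN).2 (iff_of_false hy htN))
        refine ⟨x * inr (Multiplicative.ofAdd 1), ?_⟩
        rw [map_mul, hx]
        simp [hL, f, mul_assoc, ht]
  exact ⟨φ, MulEquiv.ofBijective L hbij, hLN⟩

end SemidirectProduct

theorem Subgroup.closure_preimage_mulEquiv_eq_top_iff {A B : Type*} [Group A] [Group B]
    (e : A ≃* B) (S : Set B) : closure (e ⁻¹' S) = ⊤ ↔ closure S = ⊤ := by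
  have h : (closure (e ⁻¹' S)).map e.toMonoidHom = closure S := by
    rw [MonoidHom.map_closure]
    exact congrArg closure (Set.image_preimage_eq S e.surjective)
  rw [← h]
  have hinj : Function.Injective e.toMonoidHom := e.injective
  rw [← (map_injective hinj).eq_iff, map_top_of_surjective _ e.surjective]

/-- `G'` is a GI-extension of `G` iff there is an automorphism `σ` of `G` with
`σ ∘ σ = id` such that `G` is generated by `{g : σ g = g⁻¹}` and `G'` is isomorphic
to the semidirect product `G ⋊[σ] C₂` where the nontrivial element of `C₂` acts by `σ`. -/
theorem stmt0 (G G' : Type*) [Group G] [Fintype G] [Group G'] [Fintype G'] :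
    IsGIExtension G G' ↔
      ∃ (σ : MulAut G) (φ : Multiplicative (ZMod 2) →* MulAut G),
        σ * σ = 1 ∧
        Subgroup.closure {g : G | σ g = g⁻¹} = ⊤ ∧
        φ (Multiplicative.ofAdd 1) = σ ∧
        Nonempty (G' ≃* G ⋊[φ] Multiplicative (ZMod 2)) := by
  constructor
  · rintro ⟨N, hN, hi, ⟨e⟩, hc⟩
    obtain ⟨t, ht, htN⟩ : {x : G' | orderOf x = 2 ∧ x ∉ N}.Nonempty := by
      by_contra h
      rw [Set.not_nonempty_iff_eq_empty.1 h, Subgroup.closure_empty] at hc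
      rw [eq_top_iff.2 (hc ▸ bot_le : ⊤ ≤ N), Subgroup.index_top] at hi
      omega
    have htt : t * t = 1 := by rw [← pow_two, ← ht, pow_orderOf_eq_one]
    obtain ⟨φ, L, hL⟩ := SemidirectProduct.exists_mulEquiv_of_index_two hi e htt htN
    refine ⟨_, φ, ?_, ?_, rfl, ⟨L.symm⟩⟩
    · rw [← map_mul, ← map_one φ]
      exact congrArg φ (by decide)
    · rw [← SemidirectProduct.closure_orderOf_eq_two_eq_top_iff]
      rw [← Subgroup.closure_preimage_mulEquiv_eq_top_iff L] at hc
      simpa [hL, MulEquiv.orderOf_eq] using hc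
  · rintro ⟨_, φ, -, hσ, rfl, ⟨e⟩⟩
    let p := SemidirectProduct.rightHom.comp e.toMonoidHom
    have hp : ∀ x, x ∈ p.ker ↔ (e x).right = 1 := fun _ => Iff.rfl
    let i := e.symm.toMonoidHom.comp (SemidirectProduct.inl : G →* G ⋊[φ] _)
    have hi : i.range = p.ker := by
      ext x
      refine ⟨?_, fun hx => ⟨(e x).left, ?_⟩⟩
      · rintro ⟨g, rfl⟩
        simp [hp, i]
      · refine e.symm_apply_eq.2 (SemidirectProduct.ext rfl ((hp x).1 hx).symm)
    refine ⟨p.ker, inferInstance, ?_, ⟨(MulEquiv.subgroupCongr hi.symm).trans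
      (MonoidHom.ofInjective
        (e.symm.injective.comp SemidirectProduct.inl_injective : Function.Injective i)).symm⟩, ?_⟩
    · have hsurj : Function.Surjective p :=
        SemidirectProduct.rightHom_surjective.comp e.surjective
      rw [Subgroup.index_ker, MonoidHom.range_eq_top.2 hsurj, Subgroup.card_top]
      simp
    · rw [← SemidirectProduct.closure_orderOf_eq_two_eq_top_iff] at hσ
      rw [← Subgroup.closure_preimage_mulEquiv_eq_top_iff e] at hσ
      simpa [hp, MulEquiv.orderOf_eq] using hσ
end

section
/- Let A be a finite abelian group. Then the generalized dihedral group A ⋊ C₂, in which the nontrivial element of C₂ acts on A by inversion a ↦ a⁻¹, is a GI-extension of A; moreover, every GI-extension of A is isomorphic to this group via an isomorphism carrying the distinguished index-2 normal subgroup onto A × {1}. In particular A has a unique GI-extension. -/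
universe u

/-- `G'` is a GI-extension of `G` with distinguished subgroup `N`. -/
def IsGIExtensionAt (G : Type*) (G' : Type*) [Group G] [Group G'] (N : Subgroup G') : Prop :=
  N.Normal ∧ N.index = 2 ∧ Nonempty (N ≃* G) ∧
    Subgroup.closure {x : G' | orderOf x = 2 ∧ x ∉ N} = ⊤

/-- Every element of the multiplicative group of order two is trivial or the generator. -/
theorem multiplicative_zmod_two_cases (k : Multiplicative (ZMod 2)) :
    k = 1 ∨ k = Multiplicative.ofAdd 1 := by
  revert k; decide

/-- The homomorphism from the group of order two determined by an involution. -/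
def homOfSqEqOne {G : Type*} [Group G] (t : G) (ht : t * t = 1) :
    Multiplicative (ZMod 2) →* G where
  toFun k := if k = 1 then 1 else t
  map_one' := by simp
  map_mul' x y := by
    have h : (Multiplicative.ofAdd 1 : Multiplicative (ZMod 2)) ≠ 1 := by decide
    have h' : (Multiplicative.ofAdd 1 * Multiplicative.ofAdd 1 : Multiplicative (ZMod 2)) = 1 := by
      decide
    rcases multiplicative_zmod_two_cases x with rfl | rfl <;>
      rcases multiplicative_zmod_two_cases y with rfl | rfl <;> simp [h, h', ht]

@[simp]
theorem homOfSqEqOne_ofAdd_one {G : Type*} [Group G] (t : G) (ht : t * t = 1) :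
    homOfSqEqOne t ht (Multiplicative.ofAdd 1) = t := by
  have h : (Multiplicative.ofAdd 1 : Multiplicative (ZMod 2)) ≠ 1 := by decide
  exact if_neg (c := (Multiplicative.ofAdd 1 : Multiplicative (ZMod 2)) = 1) (t := (1 : G)) h

/-- If `N` is a commutative subgroup of index two and the group is generated by its involutions
outside `N`, then every such involution acts on `N` by inversion. -/
theorem conj_eq_inv_of_closure_eq_top {G : Type*} [Group G] {N : Subgroup G}
    (hidx : N.index = 2) (hcomm : ∀ x ∈ N, ∀ y ∈ N, x * y = y * x)
    (hgen : Subgroup.closure {x : G | orderOf x = 2 ∧ x ∉ N} = ⊤)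
    {t : G} (ht : t * t = 1) (htN : t ∉ N) {n : G} (hn : n ∈ N) :
    t * n * t⁻¹ = n⁻¹ := by
  have htinv : t⁻¹ = t := inv_eq_of_mul_eq_one_left ht
  have hmul {x y : G} : x * y ∈ N ↔ (x ∈ N ↔ y ∈ N) := Subgroup.mul_mem_iff_of_index_two hidx
  let H : Subgroup G :=
    { carrier := {x | x ∈ N ∧ t * x * t⁻¹ = x⁻¹}
      one_mem' := by simp
      mul_mem' := by
        rintro x y ⟨hx, hx'⟩ ⟨hy, hy'⟩
        refine ⟨mul_mem hx hy, ?_⟩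
        rw [hcomm x hx y hy, ← conj_mul, hx', hy', hcomm y hy x hx, mul_inv_rev]
      inv_mem' := by
        rintro x ⟨hx, hx'⟩
        exact ⟨inv_mem hx, by rw [← conj_inv, hx']⟩ }
  have hconj {x : G} (hx : x ∈ H) : t * x = x⁻¹ * t := by
    rw [← hx.2]; group
  have hconj' {x : G} (hx : x ∈ H) : x * t = t * x⁻¹ := by
    simpa using (hconj (inv_mem hx)).symm
  have key (g : G) : g ∈ H ∨ g * t ∈ H := by
    have hg : g ∈ Subgroup.closure {x : G | orderOf x = 2 ∧ x ∉ N} := hgen ▸ Subgroup.mem_top g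
    induction hg using Subgroup.closure_induction with
    | mem s hs =>
      have hss : s * s = 1 := by rw [← pow_two, ← hs.1, pow_orderOf_eq_one]
      refine Or.inr ⟨hmul.2 (iff_of_false hs.2 htN), ?_⟩
      rw [mul_inv_rev, htinv, inv_eq_of_mul_eq_one_left hss, mul_assoc, mul_assoc, ht, mul_one]
    | one => exact Or.inl (one_mem H)
    | mul x y _ _ hx hy =>
      rcases hx with hx | hx <;> rcases hy with hy | hy
      · exact Or.inl (mul_mem hx hy)
      · exact Or.inr (by simpa only [mul_assoc] using mul_mem hx hy)
      · refine Or.inr ?_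
        have := mul_mem hx (inv_mem hy)
        rwa [mul_assoc, ← hconj' hy, ← mul_assoc] at this
      · refine Or.inl ?_
        have := mul_mem hx (inv_mem hy)
        rwa [mul_assoc, ← hconj' hy, mul_assoc, ht, mul_one] at this
    | inv x _ hx =>
      rcases hx with hx | hx
      · exact Or.inl (inv_mem hx)
      · refine Or.inr ?_
        have := hx.2
        rw [mul_inv_rev, htinv, mul_assoc, mul_assoc, ht, mul_one] at this
        have h2 : x⁻¹ = x := (mul_left_cancel this).symm
        rwa [h2]
  rcases key n with h | h
  · exact h.2
  · exact absurd ((hmul.1 h.1).1 hn) htN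

section GeneralizedDihedral

variable {A : Type*} [CommGroup A] (φ : Multiplicative (ZMod 2) →* MulAut A)

/-- The generalized dihedral group of `A` is a GI-extension of `A`. -/
theorem isGIExtensionAt_semidirectProduct
    (hφ : φ (Multiplicative.ofAdd 1) = (MulEquiv.inv A : MulAut A)) :
    IsGIExtensionAt A (A ⋊[φ] Multiplicative (ZMod 2))
      (SemidirectProduct.inl : A →* A ⋊[φ] Multiplicative (ZMod 2)).range := by
  refine ⟨?_, ?_, ⟨(MonoidHom.ofInjective SemidirectProduct.inl_injective).symm⟩, ?_⟩
  · rw [SemidirectProduct.range_inl_eq_ker_rightHom]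
    infer_instance
  · rw [SemidirectProduct.range_inl_eq_ker_rightHom, Subgroup.index_ker,
      MonoidHom.range_eq_top.2 SemidirectProduct.rightHom_surjective]
    simp
  · have hne : (Multiplicative.ofAdd 1 : Multiplicative (ZMod 2)) ≠ 1 := by decide
    have hsq : (Multiplicative.ofAdd 1 * Multiplicative.ofAdd 1 : Multiplicative (ZMod 2)) = 1 := by
      decide
    have hmem (a : A) : (⟨a, Multiplicative.ofAdd 1⟩ : A ⋊[φ] Multiplicative (ZMod 2)) ∈
        Subgroup.closure {x : A ⋊[φ] Multiplicative (ZMod 2) | orderOf x = 2 ∧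
          x ∉ (SemidirectProduct.inl : A →* A ⋊[φ] Multiplicative (ZMod 2)).range} := by
      refine Subgroup.subset_closure ⟨orderOf_eq_prime ?_ ?_, ?_⟩
      · ext <;> simp [pow_two, hφ, hsq]
      · intro h
        exact hne (congrArg SemidirectProduct.right h)
      · rw [SemidirectProduct.range_inl_eq_ker_rightHom]
        exact hne
    refine eq_top_iff.2 fun g _ => ?_
    obtain ⟨a, k⟩ := g
    rcases multiplicative_zmod_two_cases k with rfl | rfl
    · have := mul_mem (hmem a) (hmem 1)
      have h : (⟨a, 1⟩ : A ⋊[φ] Multiplicative (ZMod 2)) =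
          ⟨a, Multiplicative.ofAdd 1⟩ * ⟨1, Multiplicative.ofAdd 1⟩ := by
        ext <;> simp [hsq]
      rwa [h]
    · exact hmem a

/-- Every GI-extension of `A` is isomorphic to the generalized dihedral group of `A`, compatibly
with the distinguished subgroups. -/
theorem IsGIExtensionAt.exists_mulEquiv_semidirectProduct
    (hφ : φ (Multiplicative.ofAdd 1) = (MulEquiv.inv A : MulAut A))
    {G : Type*} [Group G] {N : Subgroup G} (h : IsGIExtensionAt A G N) :
    ∃ e : G ≃* (A ⋊[φ] Multiplicative (ZMod 2)),
      Subgroup.map e.toMonoidHom N =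
        (SemidirectProduct.inl : A →* A ⋊[φ] Multiplicative (ZMod 2)).range := by
  obtain ⟨-, hidx, ⟨f⟩, hgen⟩ := h
  have hcomm (x : G) (hx : x ∈ N) (y : G) (hy : y ∈ N) : x * y = y * x := by
    have : (⟨x, hx⟩ : N) * ⟨y, hy⟩ = ⟨y, hy⟩ * ⟨x, hx⟩ :=
      f.injective (by rw [map_mul, map_mul, mul_comm])
    exact congrArg Subtype.val this
  obtain ⟨t, ht2, htN⟩ : ∃ t : G, orderOf t = 2 ∧ t ∉ N := by
    by_contra! hno
    have hle : (⊤ : Subgroup G) ≤ N :=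
      hgen ▸ (Subgroup.closure_le N).2 fun x hx => hno x hx.1
    rw [top_le_iff.1 hle, Subgroup.index_top] at hidx
    omega
  have ht : t * t = 1 := by rw [← pow_two, ← ht2, pow_orderOf_eq_one]
  let ψ : A ⋊[φ] Multiplicative (ZMod 2) →* G :=
    SemidirectProduct.lift (N.subtype.comp f.symm.toMonoidHom) (homOfSqEqOne t ht) (by
      intro k
      ext a
      rcases multiplicative_zmod_two_cases k with rfl | rfl
      · simp
      · simp [hφ, conj_eq_inv_of_closure_eq_top hidx hcomm hgen ht htN (f.symm a).2])
  have hψ_one (a : A) : ψ ⟨a, 1⟩ = f.symm a := by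
    simp [ψ, SemidirectProduct.lift]
  have hψ_gen (a : A) : ψ ⟨a, Multiplicative.ofAdd 1⟩ = f.symm a * t := by
    simp [ψ, SemidirectProduct.lift]
  have hψ_inj : Function.Injective ψ := by
    rw [injective_iff_map_eq_one]
    rintro ⟨a, k⟩ hk
    rcases multiplicative_zmod_two_cases k with rfl | rfl
    · rw [hψ_one, OneMemClass.coe_eq_one, EmbeddingLike.map_eq_one_iff] at hk
      rw [hk]
      rfl
    · rw [hψ_gen] at hk
      exact absurd (eq_inv_of_mul_eq_one_right hk ▸ inv_mem (f.symm a).2) htN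
  have hψ_surj : Function.Surjective ψ := by
    intro g
    by_cases hg : g ∈ N
    · exact ⟨⟨f ⟨g, hg⟩, 1⟩, by rw [hψ_one, f.symm_apply_apply]⟩
    · have hgt : g * t ∈ N := (Subgroup.mul_mem_iff_of_index_two hidx).2 (iff_of_false hg htN)
      refine ⟨⟨f ⟨g * t, hgt⟩, Multiplicative.ofAdd 1⟩, ?_⟩
      rw [hψ_gen, f.symm_apply_apply, mul_assoc, ht, mul_one]
  let e := MulEquiv.ofBijective ψ ⟨hψ_inj, hψ_surj⟩
  have he (a : A) : e.symm (f.symm a) = SemidirectProduct.inl a :=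
    e.symm_apply_eq.2 (hψ_one a).symm
  refine ⟨e.symm, le_antisymm ?_ ?_⟩
  · rintro _ ⟨n, hn, rfl⟩
    exact ⟨f ⟨n, hn⟩, by simp [← he]⟩
  · rintro _ ⟨a, rfl⟩
    exact ⟨f.symm a, (f.symm a).2, he a⟩

end GeneralizedDihedral

/-- For a finite abelian group `A`, the generalized dihedral group `A ⋊ C₂` (with the
nontrivial element of `C₂` acting by inversion) is a GI-extension of `A`, and every
GI-extension of `A` is isomorphic to it via an isomorphism carrying the distinguished
index-2 normal subgroup onto `A × {1}`; in particular `A` has a unique GI-extension. -/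
theorem stmt3 (A : Type*) [CommGroup A] [Fintype A]
    (φ : Multiplicative (ZMod 2) →* MulAut A)
    (hφ : φ (Multiplicative.ofAdd 1) = (MulEquiv.inv A : MulAut A)) :
    IsGIExtensionAt A (A ⋊[φ] Multiplicative (ZMod 2))
      (SemidirectProduct.inl : A →* A ⋊[φ] Multiplicative (ZMod 2)).range ∧
    ∀ (G' : Type u) [Group G'] (N : Subgroup G'), IsGIExtensionAt A G' N →
      ∃ e : G' ≃* (A ⋊[φ] Multiplicative (ZMod 2)),
        Subgroup.map e.toMonoidHom N =
          (SemidirectProduct.inl : A →* A ⋊[φ] Multiplicative (ZMod 2)).range := by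
  exact ⟨isGIExtensionAt_semidirectProduct φ hφ,
    fun _ _ _ h => h.exists_mulEquiv_semidirectProduct φ hφ⟩
end

section
/- Let G be a finite group. The direct product G × C₂ is a GI-extension of G with respect to the subgroup G × {1} — that is, G × C₂ is generated by its elements of order 2 not contained in G × {1} — if and only if G is generated by its elements of order 2. -/
theorem multiplicative_zmod_two_pow_two (a : Multiplicative (ZMod 2)) : a ^ 2 = 1 := by
  revert a; decide

theorem orderOf_eq_two_and_notMem_top_prod_bot_iff {G : Type*} [Group G]
    (x : G × Multiplicative (ZMod 2)) :
    (orderOf x = 2 ∧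
      x ∉ Subgroup.prod (⊤ : Subgroup G) (⊥ : Subgroup (Multiplicative (ZMod 2)))) ↔
      x.1 ^ 2 = 1 ∧ x.2 ≠ 1 := by
  rw [orderOf_eq_prime_iff, Subgroup.mem_prod, Subgroup.mem_bot]
  simp only [ne_eq, Prod.ext_iff, Prod.pow_fst, Prod.pow_snd, Prod.fst_one, Prod.snd_one,
    multiplicative_zmod_two_pow_two, Subgroup.mem_top]
  tauto

/-- For a finite group `G`, the direct product `G × C₂` is generated by its elements of
order 2 not contained in `G × {1}` iff `G` is generated by its elements of order 2. -/
theorem stmt4 (G : Type*) [Group G] [Fintype G] :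
    Subgroup.closure {x : G × Multiplicative (ZMod 2) |
        orderOf x = 2 ∧
          x ∉ Subgroup.prod (⊤ : Subgroup G) (⊥ : Subgroup (Multiplicative (ZMod 2)))} = ⊤ ↔
    Subgroup.closure {g : G | orderOf g = 2} = ⊤ := by
  simp only [orderOf_eq_two_and_notMem_top_prod_bot_iff]
  constructor <;> intro h
  · have hmap := congrArg (Subgroup.map (MonoidHom.fst G (Multiplicative (ZMod 2)))) h
    rw [MonoidHom.map_closure, Subgroup.map_top_of_surjective _ Prod.fst_surjective] at hmap
    rw [eq_top_iff, ← hmap, Subgroup.closure_le]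
    rintro _ ⟨x, ⟨hx, -⟩, rfl⟩
    by_cases h1 : x.1 = 1
    · simp [h1]
    · exact Subgroup.subset_closure (orderOf_eq_prime_iff.mpr ⟨hx, h1⟩)
  · set H := Subgroup.closure {x : G × Multiplicative (ZMod 2) | x.1 ^ 2 = 1 ∧ x.2 ≠ 1}
    have hsnd (a : Multiplicative (ZMod 2)) : ((1, a) : G × Multiplicative (ZMod 2)) ∈ H := by
      by_cases ha : a = 1
      · exact ha ▸ H.one_mem
      · exact Subgroup.subset_closure ⟨one_pow 2, ha⟩
    have hfst : H.comap (MonoidHom.inl G (Multiplicative (ZMod 2))) = ⊤ := by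
      rw [eq_top_iff, ← h, Subgroup.closure_le]
      intro g hg
      have hz : Multiplicative.ofAdd (1 : ZMod 2) ≠ 1 := by decide
      have hgz : (g, Multiplicative.ofAdd (1 : ZMod 2)) ∈ H :=
        Subgroup.subset_closure ⟨(orderOf_eq_prime_iff.mp hg).1, hz⟩
      simpa using H.mul_mem hgz (hsnd (Multiplicative.ofAdd 1)⁻¹)
    rw [eq_top_iff]
    rintro ⟨g, a⟩ -
    have hg : ((g, 1) : G × Multiplicative (ZMod 2)) ∈ H :=
      Subgroup.mem_comap.mp (hfst ▸ Subgroup.mem_top g)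
    simpa using H.mul_mem hg (hsnd a)
end

section
/- For every n ≥ 5, both S_n and A_n × C₂ are GI-extensions of the alternating group A_n, and S_n is not isomorphic to A_n × C₂. In particular, there exists a finite group admitting two non-isomorphic GI-extensions. -/
universe u

theorem isGIExtension_alternatingGroup_perm (n : ℕ) (hn : 2 ≤ n) :
    IsGIExtension (alternatingGroup (Fin n)) (Equiv.Perm (Fin n)) := by
  have : Nontrivial (Fin n) := Fin.nontrivial_iff_two_le.2 hn
  refine ⟨alternatingGroup (Fin n), inferInstance, alternatingGroup.index_eq_two,
    ⟨MulEquiv.refl _⟩, ?_⟩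
  rw [eq_top_iff, ← Equiv.Perm.closure_isSwap]
  refine Subgroup.closure_mono fun σ hσ => ⟨hσ.orderOf, ?_⟩
  rw [Equiv.Perm.mem_alternatingGroup, hσ.sign_eq]
  decide

/-- A group generated by elements of order dividing 2 has its product with `C₂` as a
GI-extension. -/
theorem isGIExtension_prod_zmod_two {G : Type*} [Group G] {S : Set G}
    (hS : Subgroup.closure S = ⊤) (h2 : ∀ s ∈ S, s ^ 2 = 1) :
    IsGIExtension G (G × Multiplicative (ZMod 2)) := by
  have hinj : Function.Injective (MonoidHom.inl G (Multiplicative (ZMod 2))) :=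
    fun a b h => congrArg Prod.fst h
  have hmem : ∀ s : G, s ^ 2 = 1 →
      ((s, Multiplicative.ofAdd 1) : G × Multiplicative (ZMod 2)) ∈
        {x | orderOf x = 2 ∧ x ∉ (MonoidHom.inl G (Multiplicative (ZMod 2))).range} := by
    intro s hs
    refine ⟨orderOf_eq_prime (Prod.ext hs
      (show Multiplicative.ofAdd (1 : ZMod 2) ^ 2 = 1 by decide)) fun h => ?_, ?_⟩
    · exact absurd (congrArg Prod.snd h)
        (show Multiplicative.ofAdd (1 : ZMod 2) ≠ 1 by decide)
    · rintro ⟨a, ha⟩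
      exact absurd (congrArg Prod.snd ha)
        (show (1 : Multiplicative (ZMod 2)) ≠ Multiplicative.ofAdd 1 by decide)
  have hrange : (MonoidHom.inl G (Multiplicative (ZMod 2))).range = Subgroup.prod ⊤ ⊥ := by
    ext ⟨g, c⟩
    simp [Subgroup.mem_prod, eq_comm]
  refine ⟨(MonoidHom.inl G (Multiplicative (ZMod 2))).range, ?_, ?_,
    ⟨(MonoidHom.ofInjective hinj).symm⟩, ?_⟩
  · rw [hrange]
    infer_instance
  · rw [hrange, Subgroup.index_prod]
    simp
  · set H := Subgroup.closure {x : G × Multiplicative (ZMod 2) |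
      orderOf x = 2 ∧ x ∉ (MonoidHom.inl G (Multiplicative (ZMod 2))).range}
    have hc : ((1, Multiplicative.ofAdd 1) : G × Multiplicative (ZMod 2)) ∈ H :=
      Subgroup.subset_closure (hmem 1 (one_pow 2))
    have hl : ∀ g : G, ((g, 1) : G × Multiplicative (ZMod 2)) ∈ H := by
      have : (⊤ : Subgroup G) ≤ H.comap (MonoidHom.inl G (Multiplicative (ZMod 2))) := by
        rw [← hS, Subgroup.closure_le]
        intro s hs
        have := H.mul_mem (Subgroup.subset_closure (hmem s (h2 s hs))) (H.inv_mem hc)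
        simpa using this
      exact fun g => this (Subgroup.mem_top g)
    refine eq_top_iff.2 fun ⟨g, c⟩ _ => ?_
    have hcases : ∀ c : Multiplicative (ZMod 2), c = 1 ∨ c = Multiplicative.ofAdd 1 := by decide
    rcases hcases c with rfl | rfl
    · exact hl g
    · simpa using H.mul_mem (hl g) hc

theorem perm_eq_one_of_forall_commute {α : Type*} [DecidableEq α] (h3 : 3 ≤ ENat.card α)
    {z : Equiv.Perm α} (hz : ∀ σ, Commute z σ) : z = 1 := by
  by_contra hne
  obtain ⟨a, ha⟩ : ∃ a, z a ≠ a := by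
    by_contra! h
    exact hne (Equiv.ext h)
  obtain ⟨c, hca, hcb⟩ := ENat.exists_ne_ne_of_three_le h3 a (z a)
  have := congrArg (fun f : Equiv.Perm α => f a) (hz (Equiv.swap a c)).eq
  simp [Equiv.swap_apply_of_ne_of_ne ha hcb.symm] at this
  exact hca this

theorem isEmpty_perm_mulEquiv_prod {α : Type*} (h3 : 3 ≤ ENat.card α) (G C : Type*)
    [Group G] [CommGroup C] [Nontrivial C] : IsEmpty (Equiv.Perm α ≃* G × C) := by
  classical
  refine ⟨fun e => ?_⟩
  obtain ⟨c, hc⟩ := exists_ne (1 : C)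
  have h1 : e.symm (1, c) = 1 := perm_eq_one_of_forall_commute h3 fun σ => by
    apply e.injective
    ext <;> simp [mul_comm]
  rw [map_eq_one_iff _ e.symm.injective] at h1
  exact hc (congrArg Prod.snd h1)

/-- For `n ≥ 5`, both `Sₙ` and `Aₙ × C₂` are GI-extensions of `Aₙ`, and they are not
isomorphic; in particular there is a finite group with two non-isomorphic GI-extensions. -/
theorem stmt6 (n : ℕ) (hn : 5 ≤ n) :
    (IsGIExtension (alternatingGroup (Fin n)) (Equiv.Perm (Fin n)) ∧
     IsGIExtension (alternatingGroup (Fin n))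
        (alternatingGroup (Fin n) × Multiplicative (ZMod 2)) ∧
     IsEmpty (Equiv.Perm (Fin n) ≃* alternatingGroup (Fin n) × Multiplicative (ZMod 2))) ∧
    ∃ (G G₁ G₂ : Type) (_ : Group G) (_ : Group G₁) (_ : Group G₂)
      (_ : Fintype G) (_ : Fintype G₁) (_ : Fintype G₂),
        IsGIExtension G G₁ ∧ IsGIExtension G G₂ ∧ IsEmpty (G₁ ≃* G₂) := by
  have h₁ := isGIExtension_alternatingGroup_perm n (by omega)
  have h₂ : IsGIExtension (alternatingGroup (Fin n))
      (alternatingGroup (Fin n) × Multiplicative (ZMod 2)) := by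
    refine isGIExtension_prod_zmod_two
      (alternatingGroup.closure_cycleType_eq_two_two_eq_top (by simpa using hn)) fun s hs => ?_
    rw [← orderOf_dvd_iff_pow_eq_one, ← Subgroup.orderOf_coe, ← Equiv.Perm.lcm_cycleType,
      show (s : Equiv.Perm (Fin n)).cycleType = {2, 2} from hs]
    decide
  have h₃ : IsEmpty
      (Equiv.Perm (Fin n) ≃* alternatingGroup (Fin n) × Multiplicative (ZMod 2)) :=
    isEmpty_perm_mulEquiv_prod (by simpa using (by exact_mod_cast by omega : (3 : ℕ∞) ≤ n)) _ _
  exact ⟨⟨h₁, h₂, h₃⟩, _, _, _, inferInstance, inferInstance, inferInstance,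
    inferInstance, inferInstance, inferInstance, h₁, h₂, h₃⟩
end

section
/- Let K and H be nontrivial finite groups and φ : H → Aut(K) a fixed-point-free action, and set G = K ⋊_φ H. Then the subgroup K × {1} is a characteristic subgroup of G (i.e. it is mapped onto itself by every automorphism of G), and the order of H divides |K| − 1. -/
/-- A finite group acting on a group by automorphisms without nontrivial fixed points acts freely
on the nonidentity elements, so its order divides the number of these. -/
theorem card_dvd_card_sub_one_of_fixedPointFree {K H : Type*} [Group K] [Group H] [Finite K]
    (φ : H →* MulAut K) (hfpf : ∀ (h : H) (k : K), φ h k = k → h = 1 ∨ k = 1) :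
    Nat.card H ∣ Nat.card K - 1 := by
  classical
  have := Fintype.ofFinite K
  let _ : MulAction H {k : K // k ≠ 1} :=
    { smul := fun h k => ⟨φ h k, by simpa using k.2⟩
      one_smul := fun k => Subtype.ext (by change φ 1 k.1 = k.1; simp)
      mul_smul := fun a b k => Subtype.ext (by change φ (a * b) k.1 = φ a (φ b k.1); simp) }
  have hfree : ∀ k : {k : K // k ≠ 1}, MulAction.stabilizer H k = ⊥ := fun k =>
    (Subgroup.eq_bot_iff_forall _).2 fun h hh =>
      (hfpf h k (congrArg Subtype.val (MulAction.mem_stabilizer_iff.1 hh))).resolve_right k.2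
  have hcard : Nat.card {k : K // k ≠ 1} = Nat.card K - 1 := by
    simp [Nat.card_eq_fintype_card, Fintype.card_subtype_compl]
  rw [← hcard, Nat.card_congr (MulAction.selfEquivOrbitsQuotientProd hfree), Nat.card_prod]
  exact dvd_mul_left _ _

/-- If `K` and `H` have coprime orders, the kernel of `K ⋊[φ] H` consists of the elements whose
order divides that of `K`. -/
theorem SemidirectProduct.mem_range_inl_iff_pow_card_eq_one {K H : Type*} [Group K] [Group H]
    {φ : H →* MulAut K} (hco : (Nat.card K).Coprime (Nat.card H)) (g : K ⋊[φ] H) :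
    g ∈ (SemidirectProduct.inl : K →* K ⋊[φ] H).range ↔ g ^ Nat.card K = 1 := by
  constructor
  · rintro ⟨k, rfl⟩
    rw [← map_pow, pow_card_eq_one', map_one]
  · intro hg
    rw [SemidirectProduct.range_inl_eq_ker_rightHom, MonoidHom.mem_ker, ← orderOf_eq_one_iff]
    refine Nat.eq_one_of_dvd_coprimes hco (orderOf_dvd_of_pow_eq_one ?_) (orderOf_dvd_natCard _)
    rw [← map_pow, hg, map_one]

/-- Let `K`, `H` be nontrivial finite groups and `φ : H →* Aut K` a fixed-point-free
action, so `G = K ⋊[φ] H` is a Frobenius group. Then `K × {1}` is a characteristic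
subgroup of `G`, and `|H|` divides `|K| - 1`. -/
theorem stmt8 (K H : Type*) [Group K] [Group H] [Fintype K] [Fintype H]
    [Nontrivial K] [Nontrivial H] (φ : H →* MulAut K)
    (hfpf : ∀ (h : H) (k : K), φ h k = k → h = 1 ∨ k = 1) :
    ((SemidirectProduct.inl : K →* K ⋊[φ] H).range).Characteristic ∧
    Fintype.card H ∣ Fintype.card K - 1 := by
  have hdvd := card_dvd_card_sub_one_of_fixedPointFree φ hfpf
  have hco : (Nat.card K).Coprime (Nat.card H) :=
    Nat.Coprime.coprime_dvd_right hdvd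
      ((Nat.coprime_self_sub_right Nat.card_pos).2 (Nat.coprime_one_right _))
  refine ⟨Subgroup.characteristic_iff_le_comap.2 fun e g hg => ?_, ?_⟩
  · rw [SemidirectProduct.mem_range_inl_iff_pow_card_eq_one hco] at hg
    rw [Subgroup.mem_comap, SemidirectProduct.mem_range_inl_iff_pow_card_eq_one hco, ← map_pow,
      hg, map_one]
  · simpa only [Nat.card_eq_fintype_card] using hdvd
end

section
/- Let K and H be nontrivial finite groups, φ : H → Aut(K) a fixed-point-free action, and G = K ⋊_φ H. Let α be an automorphism of G, and for h ∈ H write α(1,h) = (α₁(h), α₂(h)) with α₁(h) ∈ K and α₂(h) ∈ H. Then α₂ : H → H is an automorphism of H, and α₁ satisfies the crossed homomorphism relation α₁(h h′) = α₁(h) · φ(α₂(h))(α₁(h′)) for all h, h′ ∈ H (equivalently, α₁ ∘ α₂⁻¹ : H → K is a crossed homomorphism). -/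
/-- If a finite group `H` acts fixed-point-freely on a finite group `K`, then the orders of `K` and
`H` are coprime. -/
theorem coprime_card_of_fixedPointFree {K H : Type*} [Group K] [Group H] [Finite K] [Finite H]
    (φ : H →* MulAut K) (hfpf : ∀ (h : H) (k : K), φ h k = k → h = 1 ∨ k = 1) :
    (Nat.card K).Coprime (Nat.card H) := by
  refine Nat.Coprime.symm <| Nat.coprime_of_dvd fun p hp hpH hpK => ?_
  have : Fact p.Prime := ⟨hp⟩
  obtain ⟨h, hh⟩ := exists_prime_orderOf_dvd_card' p hpH
  let _ : MulAction (Subgroup.zpowers h) K :=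
    MulAction.compHom K (φ.comp (Subgroup.zpowers h).subtype)
  have hP : IsPGroup p (Subgroup.zpowers h) :=
    IsPGroup.of_card (n := 1) (by rw [Nat.card_zpowers, hh, pow_one])
  obtain ⟨k, hk, hk1⟩ := hP.exists_fixed_point_of_prime_dvd_card_of_fixed_point K hpK
    (a := 1) fun g => map_one (φ g)
  rcases hfpf h k (hk ⟨h, Subgroup.mem_zpowers h⟩) with rfl | rfl
  · exact hp.one_lt.ne (by simpa using hh)
  · exact hk1 rfl

/-- Let `K`, `H` be nontrivial finite groups, `φ : H →* Aut K` a fixed-point-free action,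
and `G = K ⋊[φ] H`. For an automorphism `α` of `G`, write `α (1, h) = (α₁ h, α₂ h)`.
Then `α₂` is an automorphism of `H` and `α₁` satisfies the crossed-homomorphism relation
`α₁ (h * h') = α₁ h * φ (α₂ h) (α₁ h')`. -/
theorem stmt9 (K H : Type*) [Group K] [Group H] [Fintype K] [Fintype H]
    [Nontrivial K] [Nontrivial H] (φ : H →* MulAut K)
    (hfpf : ∀ (h : H) (k : K), φ h k = k → h = 1 ∨ k = 1)
    (α : MulAut (K ⋊[φ] H)) :
    (Function.Bijective fun h : H => (α (SemidirectProduct.inr h)).right) ∧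
    (∀ h h' : H, (α (SemidirectProduct.inr (h * h'))).right =
        (α (SemidirectProduct.inr h)).right * (α (SemidirectProduct.inr h')).right) ∧
    (∀ h h' : H, (α (SemidirectProduct.inr (h * h'))).left =
        (α (SemidirectProduct.inr h)).left *
          φ ((α (SemidirectProduct.inr h)).right) ((α (SemidirectProduct.inr h')).left)) := by
  refine ⟨Finite.injective_iff_bijective.mp ?_, fun h h' => by simp, fun h h' => by simp⟩
  let f : H →* H := SemidirectProduct.rightHom.comp (α.toMonoidHom.comp SemidirectProduct.inr)
  change Function.Injective f
  refine (injective_iff_map_eq_one f).mpr fun h hh => ?_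
  obtain ⟨k, hk⟩ : α (SemidirectProduct.inr h) ∈
      (SemidirectProduct.inl : K →* K ⋊[φ] H).range := by
    rw [SemidirectProduct.range_inl_eq_ker_rightHom]
    exact hh
  have hpow : h ^ Nat.card K = 1 := by
    apply SemidirectProduct.inr_injective (φ := φ)
    apply α.injective
    rw [map_pow, map_pow, ← hk, ← map_pow, pow_card_eq_one', map_one, map_one, map_one]
  exact orderOf_eq_one_iff.mp <| Nat.eq_one_of_dvd_coprimes
    (coprime_card_of_fixedPointFree φ hfpf) (orderOf_dvd_of_pow_eq_one hpow) (orderOf_dvd_natCard h)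
end

section
/- Let K and H be nontrivial finite groups, φ : H → Aut(K) a fixed-point-free action, and G = K ⋊_φ H; let π : G → H denote the projection (k,h) ↦ h. Suppose σ ∈ Aut(K) and γ ∈ Aut(H). Then there exists an automorphism α of G satisfying α(k,1) = (σ(k),1) for all k ∈ K and π(α(1,h)) = γ(h) for all h ∈ H, if and only if for every h ∈ H the automorphism σ ∘ φ(h) ∘ σ⁻¹ ∘ φ(γ(h))⁻¹ of K is an inner automorphism of K. -/
/-- A surjective homomorphism of groups whose kernel and codomain have coprime orders splits. -/
theorem MonoidHom.exists_section_of_coprime {M H : Type*} [Group M] [Group H] (r : M →* H)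
    (hr : Function.Surjective r) (hc : (Nat.card r.ker).Coprime (Nat.card H)) :
    ∃ s : H →* M, ∀ h, r (s h) = h := by
  have hindex : r.ker.index = Nat.card H := by
    rw [Subgroup.index_ker, MonoidHom.range_eq_top.mpr hr]
    exact Nat.card_congr Subgroup.topEquiv.toEquiv
  obtain ⟨C, hC⟩ := Subgroup.exists_right_complement'_of_coprime (N := r.ker) (hindex ▸ hc)
  have hbij : Function.Bijective (r.comp C.subtype) := by
    refine ⟨(injective_iff_map_eq_one _).mpr fun c hcr ↦ ?_, fun h ↦ ?_⟩
    · exact Subtype.ext (Subgroup.disjoint_def.mp hC.disjoint hcr c.2)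
    · obtain ⟨m, rfl⟩ := hr h
      obtain ⟨⟨n, c⟩, rfl⟩ := hC.2 m
      exact ⟨c, by simp [MonoidHom.mem_ker.mp n.2]⟩
  let e := MulEquiv.ofBijective _ hbij
  exact ⟨C.subtype.comp e.symm.toMonoidHom, fun h ↦ e.apply_symm_apply h⟩

namespace SemidirectProduct

variable {K H : Type*} [Group K] [Group H] {φ : H →* MulAut K}

variable (φ) in
/-- The action of `K ⋊[φ] H` on its normal subgroup `K` by conjugation. -/
def conjAct : K ⋊[φ] H →* MulAut K :=
  lift MulAut.conj φ fun h ↦ by ext; simp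

theorem conjAct_apply (g : K ⋊[φ] H) : conjAct φ g = MulAut.conj g.left * φ g.right := rfl

theorem inl_conjAct (g : K ⋊[φ] H) (k : K) : inl (conjAct φ g k) = g * inl k * g⁻¹ := by
  ext <;> simp [conjAct_apply]

/-- A homomorphism `s : H →* K ⋊[φ] H` over an automorphism `γ` of `H`, compatible with an
automorphism `σ` of `K`, glues with `σ` to an automorphism of `K ⋊[φ] H`. -/
theorem exists_mulAut_of_section {σ : MulAut K} {γ : MulAut H} (s : H →* K ⋊[φ] H)
    (hγ : ∀ h, (s h).right = γ h) (hs : ∀ h, conjAct φ (s h) = σ * φ h * σ⁻¹) :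
    ∃ α : MulAut (K ⋊[φ] H), (∀ k, α (inl k) = inl (σ k)) ∧ ∀ h, α (inr h) = s h := by
  let f : K ⋊[φ] H →* K ⋊[φ] H := lift (inl.comp σ.toMonoidHom) s fun h ↦ by
    ext1 k
    simpa [hs] using inl_conjAct (s h) (σ k)
  have hf (g : K ⋊[φ] H) : f g = inl (σ g.left) * s g.right := rfl
  have hbij : Function.Bijective f := by
    refine ⟨(injective_iff_map_eq_one f).mpr fun g hg ↦ ?_, fun g ↦ ?_⟩
    · have hr : g.right = 1 := by
        simpa [hf, hγ] using congrArg SemidirectProduct.right hg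
      have hl : g.left = 1 := by
        simpa [hf, hr] using congrArg SemidirectProduct.left hg
      exact SemidirectProduct.ext hl hr
    · refine ⟨⟨σ⁻¹ (g.left * (s (γ⁻¹ g.right)).left⁻¹), γ⁻¹ g.right⟩, ?_⟩
      ext <;> simp [hf, hγ]
  exact ⟨MulEquiv.ofBijective f hbij, fun k ↦ by simp [hf], fun h ↦ by simp [hf]⟩

end SemidirectProduct

open SemidirectProduct in


/-- Let `K`, `H` be nontrivial finite groups, `φ : H →* Aut K` a fixed-point-free action,
`G = K ⋊[φ] H`, and `π : G → H` the projection. Given `σ ∈ Aut K` and `γ ∈ Aut H`,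
there is an automorphism `α` of `G` with `α (k, 1) = (σ k, 1)` and `π (α (1, h)) = γ h`
iff `σ ∘ φ h ∘ σ⁻¹ ∘ φ (γ h)⁻¹` is an inner automorphism of `K` for every `h`. -/
theorem stmt10 (K H : Type*) [Group K] [Group H] [Fintype K] [Fintype H]
    [Nontrivial K] [Nontrivial H] (φ : H →* MulAut K)
    (hfpf : ∀ (h : H) (k : K), φ h k = k → h = 1 ∨ k = 1)
    (σ : MulAut K) (γ : MulAut H) :
    (∃ α : MulAut (K ⋊[φ] H),
        (∀ k : K, α (SemidirectProduct.inl k) = SemidirectProduct.inl (σ k)) ∧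
        (∀ h : H, SemidirectProduct.rightHom (α (SemidirectProduct.inr h)) = γ h)) ↔
    ∀ h : H, σ * φ h * σ⁻¹ * (φ (γ h))⁻¹ ∈ (MulAut.conj : K →* MulAut K).range := by
  constructor
  · rintro ⟨α, hσ, hγ⟩ h
    refine ⟨(α (inr h)).left, ?_⟩
    have hr : (α (inr h)).right = γ h := hγ h
    rw [eq_mul_inv_iff_mul_eq, eq_mul_inv_iff_mul_eq, ← hr, ← conjAct_apply]
    ext k
    apply inl_injective (φ := φ)
    simp only [MulAut.mul_apply, inl_conjAct, ← hσ, inl_aut, map_mul, map_inv]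
  · intro hinn
    let M : Subgroup (K ⋊[φ] H) := (conjAct φ).eqLocus
      ((MulAut.conj σ).toMonoidHom.comp (φ.comp (γ⁻¹.toMonoidHom.comp rightHom)))
    let r : M →* H := rightHom.comp M.subtype
    have hr : Function.Surjective r := fun h ↦ by
      obtain ⟨u, hu⟩ := hinn (γ⁻¹ h)
      refine ⟨⟨⟨u, h⟩, ?_⟩, rfl⟩
      change conjAct φ ⟨u, h⟩ = σ * φ (γ⁻¹ h) * σ⁻¹
      rw [conjAct_apply, hu]
      simp
    have hker : Nat.card r.ker ∣ Nat.card K := by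
      have hle : r.ker.map M.subtype ≤ (inl : K →* K ⋊[φ] H).range := by
        rintro _ ⟨m, hm, rfl⟩
        rw [range_inl_eq_ker_rightHom]
        exact hm
      rw [← Subgroup.card_map_of_injective M.subtype_injective,
        Nat.card_congr (MonoidHom.ofInjective (inl_injective (φ := φ))).toEquiv]
      exact Subgroup.card_dvd_of_le hle
    obtain ⟨s, hs⟩ := r.exists_section_of_coprime hr
      ((coprime_card_of_fixedPointFree φ hfpf).coprime_dvd_left hker)
    have hsM (h : H) : conjAct φ (s h) = σ * φ (γ⁻¹ (r (s h))) * σ⁻¹ := (s h).2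
    obtain ⟨α, hα, hα'⟩ := exists_mulAut_of_section (σ := σ) (γ := γ)
      (M.subtype.comp (s.comp γ.toMonoidHom)) (fun h ↦ hs (γ h))
      fun h ↦ by simpa [hs] using hsM (γ h)
    exact ⟨α, hα, fun h ↦ by rw [hα']; exact hs (γ h)⟩
end

section
/- Let q = pⁿ be a prime power and let x ∈ F_q^× be an element of multiplicative order d ≥ 2. Then the F_p-linear span of the set {x^k − 1 : 0 ≤ k ≤ d − 1} equals the subfield F_p(x) of F_q generated by x over the prime field F_p. -/
/-- If `x` is algebraic over `K`, the subfield generated by `x` is contained in `K[x]`. -/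
theorem subfieldClosure_singleton_le_adjoin {K F : Type*} [Field K] [Field F] [Algebra K F]
    [Algebra.IsAlgebraic K F] (x : F) {y : F} (hy : y ∈ Subfield.closure {x}) :
    y ∈ Algebra.adjoin K {x} := by
  let L : Subfield F :=
    { (Algebra.adjoin K {x}).toSubring with
      inv_mem' := fun z hz => (Algebra.adjoin K {x}).inv_mem_of_algebraic (x := ⟨z, hz⟩)
        (Algebra.IsAlgebraic.isAlgebraic z) }
  have hL : Subfield.closure {x} ≤ L :=
    Subfield.closure_le.2 (Set.singleton_subset_iff.2 (Algebra.self_mem_adjoin_singleton K x))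
  exact hL hy

/-- A submodule containing every `x ^ k - 1` contains `(x - 1) K[x]`. -/
theorem sub_one_mul_mem_of_mem_adjoin {K A : Type*} [CommRing K] [CommRing A] [Algebra K A]
    {x : A} {S : Submodule K A} (hS : ∀ k : ℕ, x ^ k - 1 ∈ S) {z : A}
    (hz : z ∈ Algebra.adjoin K {x}) : (x - 1) * z ∈ S := by
  rw [← Subalgebra.mem_toSubmodule, Algebra.adjoin_eq_span] at hz
  induction hz using Submodule.span_induction with
  | mem z hz =>
    obtain ⟨k, rfl⟩ := Submonoid.mem_closure_singleton.1 hz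
    have h := S.sub_mem (hS (k + 1)) (hS k)
    rwa [show x ^ (k + 1) - 1 - (x ^ k - 1) = (x - 1) * x ^ k by ring] at h
  | zero => simp
  | add a b _ _ ha hb => rw [mul_add]; exact S.add_mem ha hb
  | smul c a _ ha => rw [mul_smul_comm]; exact S.smul_mem c ha

/-- Let `q = pⁿ` and `x ∈ F_q^×` of multiplicative order `d ≥ 2`. Then the `F_p`-linear
span of `{x ^ k - 1 : 0 ≤ k ≤ d - 1}` equals the subfield `F_p(x)` of `F_q` generated
by `x` over the prime field. -/
theorem stmt15 (p n d : ℕ) (hp : p.Prime) (F : Type*) [Field F] [Fintype F]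
    [Algebra (ZMod p) F] (hF : Fintype.card F = p ^ n)
    (x : Fˣ) (hx : orderOf x = d) (hd : 2 ≤ d) :
    (Submodule.span (ZMod p) {y : F | ∃ k : ℕ, k ≤ d - 1 ∧ y = (x : F) ^ k - 1} : Set F) =
      (Subfield.closure {(x : F)} : Set F) := by
  have : Fact p.Prime := ⟨hp⟩
  set S := Submodule.span (ZMod p) {y : F | ∃ k : ℕ, k ≤ d - 1 ∧ y = (x : F) ^ k - 1}
  have hxK : (x : F) ∈ Subfield.closure {(x : F)} := Subfield.subset_closure rfl
  apply Set.Subset.antisymm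
  · intro y hy
    induction hy using Submodule.span_induction with
    | mem y hy =>
      obtain ⟨k, -, rfl⟩ := hy
      exact sub_mem (pow_mem hxK k) (one_mem _)
    | zero => exact zero_mem _
    | add a b _ _ ha hb => exact add_mem ha hb
    | smul c a _ ha =>
      obtain ⟨m, rfl⟩ := ZMod.natCast_zmod_surjective c
      rw [Nat.cast_smul_eq_nsmul]
      exact nsmul_mem ha m
  · intro y hy
    have hpow : ∀ k : ℕ, (x : F) ^ k - 1 ∈ S := fun k => by
      refine Submodule.subset_span ⟨k % d, ?_, ?_⟩
      · have := Nat.mod_lt k (show 0 < d by lia)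
        lia
      · rw [← hx, ← Units.val_pow_eq_pow_val, ← Units.val_pow_eq_pow_val, pow_mod_orderOf]
    have hx1 : (x : F) - 1 ≠ 0 := fun h => by
      have h1 : x = 1 := Units.ext (sub_eq_zero.1 h)
      rw [h1, orderOf_one] at hx
      lia
    have hz : ((x : F) - 1)⁻¹ * y ∈ Subfield.closure {(x : F)} :=
      mul_mem (inv_mem (sub_mem hxK (one_mem _))) hy
    have h := sub_one_mul_mem_of_mem_adjoin hpow
      (subfieldClosure_singleton_le_adjoin (K := ZMod p) (x : F) hz)
    rwa [mul_inv_cancel_left₀ hx1] at h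
end

section
/- Let n be a positive odd integer, χ a Dirichlet character, and s a complex number with Re(s) > 1. Then M_n^+(s,χ) · ∏_{q prime, (q|n) = −1} (1 − 4 χ(q)² q^{−2s}) = M_n^-(s,χ) · ∏_{q prime} (1 + 2 χ(q) (q|n) q^{−s}), where (q|n) denotes the Jacobi symbol and all products converge absolutely. -/
open scoped Classical

/-- The general term of the series `M_nᵉ(s,χ) = Σ 2^{ω(m)} χ(m) m^{-s}`, the sum
ranging over squarefree positive integers `m` all of whose prime divisors `q` satisfy
`J(q|n) = ε` (Jacobi symbol). -/
noncomputable def Mterm (n : ℕ) {N : ℕ} (χ : DirichletCharacter ℂ N) (ε : ℤ) (s : ℂ)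
    (m : ℕ) : ℂ :=
  if Squarefree m ∧ ∀ q : ℕ, q.Prime → q ∣ m → jacobiSym q n = ε then
    2 ^ m.primeFactors.card * χ (m : ZMod N) * (m : ℂ) ^ (-s)
  else 0

open LSeries.notation in
theorem summable_card_divisors_mul_rpow {σ : ℝ} (hσ : 1 < σ) :
    Summable fun m : ℕ => (m.divisors.card : ℝ) * (m : ℝ) ^ (-σ) := by
  have h1 : LSeriesSummable 1 (σ : ℂ) := LSeriesSummable_one_iff.mpr (by simpa using hσ)
  have h2 := (h1.convolution h1).norm
  refine h2.congr fun m => ?_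
  rcases eq_or_ne m 0 with rfl | hm
  · simp
  · rw [LSeries.term_of_ne_zero hm, LSeries.convolution_def]
    have hm' : 0 < m := Nat.pos_of_ne_zero hm
    simp [Complex.norm_natCast_cpow_of_pos hm', Real.rpow_neg, div_eq_mul_inv,
      ← Nat.map_div_right_divisors]

theorem two_pow_card_primeFactors_le_card_divisors {m : ℕ} (hm : m ≠ 0) :
    2 ^ m.primeFactors.card ≤ m.divisors.card := by
  rw [Nat.card_divisors hm]
  refine Finset.pow_card_le_prod _ _ _ fun p hp => ?_
  have hp' := Nat.mem_primeFactors.mp hp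
  have := hp'.1.factorization_pos_of_dvd hm hp'.2.1
  lia

section Mterm

variable (n : ℕ) {N : ℕ} (χ : DirichletCharacter ℂ N) (ε : ℤ) {s : ℂ}

theorem summable_norm_Mterm (hs : 1 < s.re) : Summable (‖Mterm n χ ε s ·‖) := by
  refine (summable_card_divisors_mul_rpow hs).of_nonneg_of_le (fun _ => norm_nonneg _) fun m => ?_
  rw [Mterm]
  split_ifs with h
  · have hm : m ≠ 0 := h.1.ne_zero
    rw [norm_mul, norm_mul, Complex.norm_natCast_cpow_of_pos (Nat.pos_of_ne_zero hm), norm_pow,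
      Complex.norm_ofNat, Complex.neg_re]
    gcongr
    calc (2 : ℝ) ^ m.primeFactors.card * ‖χ (m : ZMod N)‖
        ≤ 2 ^ m.primeFactors.card * 1 := by gcongr; exact χ.norm_le_one _
      _ ≤ m.divisors.card := by
        rw [mul_one]; exact_mod_cast two_pow_card_primeFactors_le_card_divisors hm
  · rw [norm_zero]; positivity

variable (s) in
theorem Mterm_one : Mterm n χ ε s 1 = 1 := by
  rw [Mterm, if_pos ⟨squarefree_one, fun q hq hd => absurd (Nat.dvd_one.mp hd) hq.ne_one⟩]
  simp

variable (s) in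
theorem Mterm_mul_of_coprime {a b : ℕ} (hab : a.Coprime b) :
    Mterm n χ ε s (a * b) = Mterm n χ ε s a * Mterm n χ ε s b := by
  have key : (Squarefree (a * b) ∧ ∀ q : ℕ, q.Prime → q ∣ a * b → jacobiSym q n = ε) ↔
      (Squarefree a ∧ ∀ q : ℕ, q.Prime → q ∣ a → jacobiSym q n = ε) ∧
      (Squarefree b ∧ ∀ q : ℕ, q.Prime → q ∣ b → jacobiSym q n = ε) := by
    rw [Nat.squarefree_mul hab]
    constructor
    · rintro ⟨⟨ha, hb⟩, h⟩
      exact ⟨⟨ha, fun q hq hd => h q hq (hd.mul_right _)⟩,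
        ⟨hb, fun q hq hd => h q hq (hd.mul_left _)⟩⟩
    · rintro ⟨⟨ha, h⟩, hb, h'⟩
      exact ⟨⟨ha, hb⟩, fun q hq hd => ((hq.dvd_mul).mp hd).elim (h q hq) (h' q hq)⟩
  simp only [Mterm, key]
  by_cases h1 : Squarefree a ∧ ∀ q : ℕ, q.Prime → q ∣ a → jacobiSym q n = ε
  · by_cases h2 : Squarefree b ∧ ∀ q : ℕ, q.Prime → q ∣ b → jacobiSym q n = ε
    · rw [if_pos ⟨h1, h2⟩, if_pos h1, if_pos h2, hab.primeFactors_mul,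
        Finset.card_union_of_disjoint hab.disjoint_primeFactors, Nat.cast_mul, Nat.cast_mul,
        map_mul, Complex.natCast_mul_natCast_cpow, pow_add]
      ring
    · rw [if_neg fun h => h2 h.2, if_neg h2, mul_zero]
  · rw [if_neg fun h => h1 h.1, if_neg h1, zero_mul]

variable (s) in
theorem tsum_Mterm_prime_pow {p : ℕ} (hp : p.Prime) :
    ∑' e, Mterm n χ ε s (p ^ e) =
      1 + if jacobiSym p n = ε then 2 * χ (p : ZMod N) * (p : ℂ) ^ (-s) else 0 := by
  rw [tsum_eq_sum (s := Finset.range 2)]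
  · have hpe : (Squarefree p ∧ ∀ q : ℕ, q.Prime → q ∣ p → jacobiSym q n = ε) ↔
        jacobiSym p n = ε := by
      refine ⟨fun h => h.2 p hp dvd_rfl, fun h => ⟨hp.prime.squarefree, fun q hq hd => ?_⟩⟩
      rwa [(Nat.prime_dvd_prime_iff_eq hq hp).mp hd]
    rw [Finset.sum_range_succ, Finset.sum_range_one, pow_zero, pow_one, Mterm_one, Mterm]
    simp only [hpe, hp.primeFactors, Finset.card_singleton, pow_one]
  · intro e he
    rw [Finset.mem_range, not_lt] at he
    refine if_neg fun h => ?_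
    have := (Nat.squarefree_pow_iff hp.ne_one (by lia)).mp h.1
    lia

theorem hasProd_tsum_Mterm (hs : 1 < s.re) :
    HasProd (fun q : ℕ => if q.Prime ∧ jacobiSym q n = ε then
      1 + 2 * χ (q : ZMod N) * (q : ℂ) ^ (-s) else 1) (∑' m, Mterm n χ ε s m) := by
  have h0 : Mterm n χ ε s 0 = 0 := if_neg fun h => not_squarefree_zero h.1
  convert EulerProduct.eulerProduct_hasProd_mulIndicator (Mterm_one n χ ε s)
    (Mterm_mul_of_coprime n χ ε s) (summable_norm_Mterm n χ ε hs) h0 using 2 with q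
  by_cases hq : q.Prime
  · rw [Set.mulIndicator_of_mem (show q ∈ {p | Nat.Prime p} from hq),
      tsum_Mterm_prime_pow n χ ε s hq]
    by_cases h : jacobiSym q n = ε <;> simp [hq, h]
  · rw [Set.mulIndicator_of_notMem (show q ∉ {p | Nat.Prime p} from hq), if_neg fun h => hq h.1]

end Mterm

theorem norm_jacobiSym_le_one (a : ℤ) (n : ℕ) : ‖(jacobiSym a n : ℂ)‖ ≤ 1 := by
  rcases jacobiSym.trichotomy a n with h | h | h <;> simp [h]

theorem summable_norm_natCast_cpow_neg {s : ℂ} (hs : 1 < s.re) :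
    Summable fun q : ℕ => ‖(q : ℂ) ^ (-s)‖ := by
  refine (Real.summable_nat_rpow.mpr (show -s.re < -1 by linarith)).congr fun q => ?_
  rw [Complex.norm_natCast_cpow_of_re_ne_zero q (by rw [Complex.neg_re]; linarith), Complex.neg_re]

/-- For `n` odd, `Re(s) > 1`:
`M_n⁺(s,χ) ⬝ ∏_{q prime, (q|n) = -1} (1 - 4χ(q)²q^{-2s})
  = M_n⁻(s,χ) ⬝ ∏_{q prime} (1 + 2χ(q)(q|n)q^{-s})`,
with all products converging absolutely. -/
theorem stmt18 (n : ℕ) (hn : Odd n) (hn0 : 0 < n) (N : ℕ) (χ : DirichletCharacter ℂ N)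
    (s : ℂ) (hs : 1 < s.re) :
    Summable (fun q : ℕ =>
      ‖if q.Prime ∧ jacobiSym q n = -1 then
          -(4 * χ (q : ZMod N) ^ 2 * (q : ℂ) ^ (-(2 * s))) else 0‖) ∧
    Summable (fun q : ℕ =>
      ‖if q.Prime then 2 * χ (q : ZMod N) * (jacobiSym q n : ℂ) * (q : ℂ) ^ (-s) else 0‖) ∧
    Multipliable (fun q : ℕ =>
      if q.Prime ∧ jacobiSym q n = -1 then
        1 - 4 * χ (q : ZMod N) ^ 2 * (q : ℂ) ^ (-(2 * s)) else 1) ∧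
    Multipliable (fun q : ℕ =>
      if q.Prime then 1 + 2 * χ (q : ZMod N) * (jacobiSym q n : ℂ) * (q : ℂ) ^ (-s) else 1) ∧
    (∑' m : ℕ, Mterm n χ 1 s m) *
        (∏' q : ℕ,
          if q.Prime ∧ jacobiSym q n = -1 then
            1 - 4 * χ (q : ZMod N) ^ 2 * (q : ℂ) ^ (-(2 * s)) else 1) =
      (∑' m : ℕ, Mterm n χ (-1) s m) *
        (∏' q : ℕ,
          if q.Prime then
            1 + 2 * χ (q : ZMod N) * (jacobiSym q n : ℂ) * (q : ℂ) ^ (-s) else 1) := by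
  have hs2 : 1 < (2 * s).re := by simp; linarith
  have hS1 : Summable (fun q : ℕ =>
      ‖if q.Prime ∧ jacobiSym q n = -1 then
          -(4 * χ (q : ZMod N) ^ 2 * (q : ℂ) ^ (-(2 * s))) else 0‖) := by
    refine ((summable_norm_natCast_cpow_neg hs2).mul_left 4).of_nonneg_of_le
      (fun _ => norm_nonneg _) fun q => ?_
    split_ifs
    · rw [norm_neg, norm_mul, norm_mul, norm_pow, Complex.norm_ofNat]
      gcongr
      have := pow_le_one₀ (n := 2) (norm_nonneg _) (χ.norm_le_one (q : ZMod N))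
      linarith
    · rw [norm_zero]; positivity
  have hS2 : Summable (fun q : ℕ =>
      ‖if q.Prime then 2 * χ (q : ZMod N) * (jacobiSym q n : ℂ) * (q : ℂ) ^ (-s) else 0‖) := by
    refine ((summable_norm_natCast_cpow_neg hs).mul_left 2).of_nonneg_of_le
      (fun _ => norm_nonneg _) fun q => ?_
    split_ifs
    · rw [norm_mul, norm_mul, norm_mul, Complex.norm_ofNat]
      gcongr
      have := mul_le_one₀ (χ.norm_le_one (q : ZMod N)) (norm_nonneg _) (norm_jacobiSym_le_one q n)
      linarith
    · rw [norm_zero]; positivity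
  have hM1 : Multipliable (fun q : ℕ =>
      if q.Prime ∧ jacobiSym q n = -1 then
        1 - 4 * χ (q : ZMod N) ^ 2 * (q : ℂ) ^ (-(2 * s)) else 1) := by
    refine (multipliable_one_add_of_summable hS1).congr fun q => ?_
    split_ifs <;> ring
  have hM2 : Multipliable (fun q : ℕ =>
      if q.Prime then 1 + 2 * χ (q : ZMod N) * (jacobiSym q n : ℂ) * (q : ℂ) ^ (-s) else 1) := by
    refine (multipliable_one_add_of_summable hS2).congr fun q => ?_
    split_ifs <;> ring
  refine ⟨hS1, hS2, hM1, hM2, ?_⟩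
  have hP := hasProd_tsum_Mterm n χ 1 hs
  have hQ := hasProd_tsum_Mterm n χ (-1) hs
  rw [← hP.tprod_eq, ← hQ.tprod_eq, ← hP.multipliable.tprod_mul hM1,
    ← hQ.multipliable.tprod_mul hM2]
  refine tprod_congr fun q => ?_
  by_cases hq : q.Prime
  · have hpow : (q : ℂ) ^ (-(2 * s)) = ((q : ℂ) ^ (-s)) ^ 2 := by
      rw [← Complex.cpow_nat_mul]; congr 1; push_cast; ring
    rcases jacobiSym.trichotomy q n with h | h | h
    · simp [hq, h]
    · simp [hq, h]
    · simp only [hq, h, hpow]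
      norm_num
      ring
  · simp [hq]
end

section
/- Let χ be a Dirichlet character and let a be a positive integer. Then there exists a function F : ℂ → ℂ which is holomorphic on the half-plane {s : Re(s) > 1/2} such that for every complex s with Re(s) > 1, ∏_{p prime} (1 + a χ(p) p^{−s}) = F(s) · L(s,χ)^a, where the product over primes converges absolutely and L(s,χ) = Σ_{m ≥ 1} χ(m) m^{−s} is the Dirichlet L-series of χ. -/
open scoped Classical

/-- To first order, `(1 - z) ^ a` is `1 - a * z`, with a continuous second-order coefficient. -/
lemma exists_continuous_one_sub_pow_eq (a : ℕ) :
    ∃ r : ℂ → ℂ, Continuous r ∧ ∀ z, (1 - z) ^ a = 1 - a * z + z ^ 2 * r z := by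
  induction a with
  | zero => exact ⟨0, continuous_const, fun z => by simp⟩
  | succ a ih =>
    obtain ⟨r, hr, h⟩ := ih
    refine ⟨fun z => a + (1 - z) * r z, by fun_prop, fun z => ?_⟩
    rw [pow_succ, h]
    push_cast
    ring

/-- On the closed unit disc, `(1 + a * z) * (1 - z) ^ a` differs from `1` by `O(z ^ 2)`. -/
lemma exists_norm_one_add_mul_one_sub_pow_sub_one_le (a : ℕ) :
    ∃ C : ℝ, 0 ≤ C ∧
      ∀ z : ℂ, ‖z‖ ≤ 1 → ‖(1 + a * z) * (1 - z) ^ a - 1‖ ≤ C * ‖z‖ ^ 2 := by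
  obtain ⟨r, hr, h⟩ := exists_continuous_one_sub_pow_eq a
  obtain ⟨C, hC⟩ := (isCompact_closedBall (0 : ℂ) 1).exists_bound_of_continuousOn
    (f := fun z => (1 + a * z) * r z - a ^ 2) (by fun_prop)
  refine ⟨C, (norm_nonneg _).trans (hC 0 (by simp)), fun z hz => ?_⟩
  have key : (1 + a * z) * (1 - z) ^ a - 1 = ((1 + a * z) * r z - a ^ 2) * z ^ 2 := by
    rw [h]
    ring
  rw [key, norm_mul, norm_pow]
  gcongr
  exact hC z (by simpa using hz)

/-- A holomorphic version of the Weierstrass M-test for infinite products, with a bound that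
may depend on the half-plane. -/
lemma differentiableOn_tprod_one_add_of_summable_norm {ι : Type*} {f : ι → ℂ → ℂ} {b : ℝ}
    (hf : ∀ i, Differentiable ℂ (f i))
    (hu : ∀ σ, b < σ → ∃ u : ι → ℝ, Summable u ∧ ∀ i s, σ < s.re → ‖f i s‖ ≤ u i) :
    DifferentiableOn ℂ (fun s => ∏' i, (1 + f i s)) {s : ℂ | b < s.re} := by
  intro s hs
  obtain ⟨σ, hbσ, hσs⟩ := exists_between (Set.mem_ofPred.mp hs)
  obtain ⟨u, husum, hle⟩ := hu σ hbσ
  have hopen : IsOpen {s : ℂ | σ < s.re} := isOpen_lt continuous_const Complex.continuous_re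
  have hprod := Summable.hasProdLocallyUniformlyOn_one_add (f := f) hopen husum
    (.of_forall fun i x hx => hle i x hx) fun i => (hf i).continuous.continuousOn
  have hdiff : DifferentiableOn ℂ (fun s => ∏' i, (1 + f i s)) {s : ℂ | σ < s.re} := by
    refine TendstoLocallyUniformlyOn.differentiableOn
      (hasProdLocallyUniformlyOn_iff_tendstoLocallyUniformlyOn.mp hprod)
      (.of_forall fun t => ?_) hopen
    have := hf
    fun_prop
  exact (hdiff.differentiableAt (hopen.mem_nhds hσs)).differentiableWithinAt

lemma norm_dirichletCharacter_mul_prime_cpow_le {N : ℕ} (χ : DirichletCharacter ℂ N)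
    (p : Nat.Primes) {s : ℂ} {σ : ℝ} (hσ : σ ≤ s.re) :
    ‖χ (p : ZMod N) * (p : ℂ) ^ (-s)‖ ≤ (p : ℝ) ^ (-σ) := by
  rw [norm_mul, Complex.norm_natCast_cpow_of_pos p.prop.pos, Complex.neg_re]
  refine (mul_le_of_le_one_left (by positivity) (χ.norm_le_one _)).trans ?_
  exact Real.rpow_le_rpow_of_exponent_le (mod_cast p.prop.one_le) (by linarith)

/-- Let `χ` be a Dirichlet character and `a` a positive integer. Then there is a
function `F` holomorphic on `Re(s) > 1/2` such that for all `s` with `Re(s) > 1`,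
the absolutely convergent Euler product `∏_p (1 + a χ(p) p^{-s})` equals
`F(s) ⬝ L(s,χ)^a`, where `L(s,χ)` is the Dirichlet `L`-series of `χ`. -/
theorem stmt19 (N : ℕ) (χ : DirichletCharacter ℂ N) (a : ℕ) (ha : 0 < a) :
    ∃ F : ℂ → ℂ, DifferentiableOn ℂ F {s : ℂ | 1 / 2 < s.re} ∧
      ∀ s : ℂ, 1 < s.re →
        Summable (fun p : ℕ =>
          ‖if p.Prime then (a : ℂ) * χ (p : ZMod N) * (p : ℂ) ^ (-s) else 0‖) ∧
        Multipliable (fun p : ℕ =>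
          if p.Prime then 1 + (a : ℂ) * χ (p : ZMod N) * (p : ℂ) ^ (-s) else 1) ∧
        (∏' p : ℕ, if p.Prime then 1 + (a : ℂ) * χ (p : ZMod N) * (p : ℂ) ^ (-s) else 1) =
          F s * (LSeries (fun m : ℕ => χ (m : ZMod N)) s) ^ a := by

  obtain ⟨C, hC, hbound⟩ := exists_norm_one_add_mul_one_sub_pow_sub_one_le a
  let z : Nat.Primes → ℂ → ℂ := fun p s => χ (p : ZMod N) * (p : ℂ) ^ (-s)
  let f : Nat.Primes → ℂ → ℂ := fun p s => (1 + a * z p s) * (1 - z p s) ^ a - 1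
  have hz_le (p : Nat.Primes) {s : ℂ} {σ : ℝ} (hσ : σ ≤ s.re) : ‖z p s‖ ≤ (p : ℝ) ^ (-σ) :=
    norm_dirichletCharacter_mul_prime_cpow_le χ p hσ
  have hf_diff (p : Nat.Primes) : Differentiable ℂ (f p) := by
    have hp : (p : ℂ) ≠ 0 := mod_cast p.prop.ne_zero
    have : Differentiable ℂ (z p) :=
      (differentiable_id.neg.const_cpow (.inl hp)).const_mul _
    fun_prop
  have hf_le (σ : ℝ) (hσ : 1 / 2 < σ) :
      ∃ u : Nat.Primes → ℝ, Summable u ∧ ∀ p s, σ < s.re → ‖f p s‖ ≤ u p := by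
    refine ⟨fun p => C * (p : ℝ) ^ (-(2 * σ)),
      (Nat.Primes.summable_rpow.mpr (by linarith)).mul_left C, fun p s hs => ?_⟩
    have hzσ := hz_le p hs.le
    have hz1 : ‖z p s‖ ≤ 1 := hzσ.trans <|
      Real.rpow_le_one_of_one_le_of_nonpos (mod_cast p.prop.one_le) (by linarith)
    refine (hbound _ hz1).trans ?_
    have hsq : (p : ℝ) ^ (-(2 * σ)) = ((p : ℝ) ^ (-σ)) ^ 2 := by
      rw [← Real.rpow_mul_natCast (by positivity)]
      congr 1
      push_cast
      ring
    calc C * ‖z p s‖ ^ 2 ≤ C * ((p : ℝ) ^ (-σ)) ^ 2 := by gcongr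
      _ = C * (p : ℝ) ^ (-(2 * σ)) := by rw [hsq]
  refine ⟨fun s => ∏' p, (1 + f p s),
    differentiableOn_tprod_one_add_of_summable_norm hf_diff hf_le, fun s hs => ?_⟩
  have hz_lt (p : Nat.Primes) : ‖z p s‖ < 1 := (hz_le p hs.le).trans_lt <|
    Real.rpow_lt_one_of_one_lt_of_neg (mod_cast p.prop.one_lt) (by norm_num)
  have hz_ne (p : Nat.Primes) : 1 - z p s ≠ 0 := fun h => by
    have := hz_lt p
    rw [← sub_eq_zero.mp h] at this
    simp at this
  have hsum : Summable fun p : Nat.Primes => ‖(a : ℂ) * χ (p : ZMod N) * (p : ℂ) ^ (-s)‖ := by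
    refine Summable.of_nonneg_of_le (fun _ => norm_nonneg _) (fun p => ?_)
      ((Nat.Primes.summable_rpow.mpr (neg_lt_neg hs)).mul_left (a : ℝ))
    rw [mul_assoc, norm_mul, Complex.norm_natCast]
    gcongr
    exact hz_le p le_rfl
  have hF : HasProd (fun p => 1 + f p s) (∏' p, (1 + f p s)) := by
    obtain ⟨σ, hσ, hσs⟩ := exists_between (show (1 / 2 : ℝ) < s.re by linarith)
    obtain ⟨u, hu, hle⟩ := hf_le σ hσ
    exact (multipliable_one_add_of_summable
      (hu.of_nonneg_of_le (fun _ => norm_nonneg _) fun p => hle p s hσs)).hasProd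
  have hprod : HasProd
      (fun p : Nat.Primes => 1 + (a : ℂ) * χ (p : ZMod N) * (p : ℂ) ^ (-s))
      ((∏' p, (1 + f p s)) * (LSeries (fun m : ℕ => χ (m : ZMod N)) s) ^ a) := by
    convert hF.mul ((DirichletCharacter.LSeries_eulerProduct_hasProd χ hs).pow a) using 2 with p
    change _ = (1 + ((1 + a * z p s) * (1 - z p s) ^ a - 1)) * (1 - z p s)⁻¹ ^ a
    rw [add_sub_cancel, inv_pow, mul_inv_cancel_right₀ (pow_ne_zero a (hz_ne p)), mul_assoc]
  have hprod' := (Nat.Primes.hasProd_iff_hasProd_ite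
    fun p : ℕ => 1 + (a : ℂ) * χ (p : ZMod N) * (p : ℂ) ^ (-s)).mp hprod
  refine ⟨?_, hprod'.multipliable, hprod'.tprod_eq⟩
  simpa only [apply_ite norm, norm_zero] using (Nat.Primes.summable_iff_summable_ite
    fun p : ℕ => ‖(a : ℂ) * χ (p : ZMod N) * (p : ℂ) ^ (-s)‖).mp hsum
end
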